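/- Suppose a : ℕ → ℝ is an arithmetical function and (a_q)_{q≥1} is a sequence of real numbers such that the series Σ_{q=1}^∞ a_q c_q(n) converges to a(n) absolutely and uniformly in n (i.e. Σ_{q=1}^∞ sup_{n≥1} |a_q c_q(n)| < ∞). Then for every positive integer h, lim_{N→∞} (1/N) Σ_{n≤N} a(n) a(n+h) = Σ_{q=1}^∞ a_q² c_q(h). -/

import Mathlib

open Finset Filter

/-- The (real-valued) Ramanujan sum `c_q(n) = ∑_{k=1, gcd(k,q)=1}^{q} e^{2πi k n / q}
= ∑_{k=1, gcd(k,q)=1}^{q} cos(2π k n / q)`. -/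
noncomputable def ramanujanSum (q n : ℕ) : ℝ :=
  ∑ k ∈ (Finset.Icc 1 q).filter (fun k => Nat.gcd k q = 1),
    Real.cos (2 * Real.pi * k * n / q)

theorem tendsto_mean_cos_zero (γ δ : ℝ) (hγ : Real.sin (γ / 2) ≠ 0) :
    Tendsto (fun N : ℕ => (1 / (N : ℝ)) * ∑ n ∈ Finset.Icc 1 N, Real.cos (γ * n + δ))
      atTop (nhds 0) := by
  have tele : ∀ N : ℕ, 2 * Real.sin (γ / 2) * ∑ n ∈ Finset.Icc 1 N, Real.cos (γ * n + δ)
      = Real.sin (γ * N + δ + γ / 2) - Real.sin (δ + γ / 2) := by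
    intro N
    induction N with
    | zero => simp
    | succ N ih =>
      rw [Finset.sum_Icc_succ_top (by omega), mul_add, ih]
      have e : γ * N + δ + γ / 2 = (γ * (N + 1 : ℕ) + δ) - γ / 2 := by push_cast; ring
      rw [e, Real.sin_sub, Real.sin_add (γ * (N + 1 : ℕ) + δ)]
      ring
  refine (tendsto_one_div_atTop_nhds_zero_nat (𝕜 := ℝ)).zero_mul_isBoundedUnder_le ?_
  refine isBoundedUnder_of ⟨1 / |Real.sin (γ / 2)|, fun N => ?_⟩
  have hpos : 0 < |Real.sin (γ / 2)| := abs_pos.mpr hγ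
  have hb : |2 * Real.sin (γ / 2) * ∑ n ∈ Finset.Icc 1 N, Real.cos (γ * n + δ)| ≤ 2 := by
    rw [tele, abs_le]
    constructor <;>
    linarith [Real.sin_le_one (γ * N + δ + γ / 2), Real.neg_one_le_sin (γ * N + δ + γ / 2),
      Real.sin_le_one (δ + γ / 2), Real.neg_one_le_sin (δ + γ / 2)]
  rw [abs_mul, abs_mul, abs_two] at hb
  simp only [Function.comp_apply, Real.norm_eq_abs]
  rw [le_div_iff₀ hpos]
  linarith

theorem sum_coprime_sin_eq_zero (q n : ℕ) :
    ∑ k ∈ (Finset.Icc 1 q).filter (fun k => Nat.gcd k q = 1),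
      Real.sin (2 * Real.pi * k * n / q) = 0 := by
  rcases Nat.lt_or_ge 1 q with hq | hq
  · have hq0 : (q : ℝ) ≠ 0 := by positivity
    have lt_of_mem : ∀ k ∈ (Finset.Icc 1 q).filter (fun k => Nat.gcd k q = 1), k < q := by
      intro k hk
      simp only [Finset.mem_filter, Finset.mem_Icc] at hk
      refine lt_of_le_of_ne hk.1.2 ?_
      rintro rfl
      simp at hk
      omega
    have reflect := Finset.sum_nbij' (s := (Finset.Icc 1 q).filter (fun k => Nat.gcd k q = 1))
      (t := (Finset.Icc 1 q).filter (fun k => Nat.gcd k q = 1))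
      (f := fun k : ℕ => Real.sin (2 * Real.pi * k * n / q))
      (g := fun k : ℕ => -Real.sin (2 * Real.pi * k * n / q))
      (fun k => q - k) (fun k => q - k) ?_ ?_ ?_ ?_ ?_
    · rw [Finset.sum_neg_distrib] at reflect
      linarith
    · intro k hk
      have := lt_of_mem k hk
      simp only [Finset.mem_filter, Finset.mem_Icc] at hk ⊢
      exact ⟨by omega, (Nat.gcd_self_sub_left hk.1.2).trans hk.2⟩
    · intro k hk
      have := lt_of_mem k hk
      simp only [Finset.mem_filter, Finset.mem_Icc] at hk ⊢
      exact ⟨by omega, (Nat.gcd_self_sub_left hk.1.2).trans hk.2⟩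
    · intro k hk
      have := lt_of_mem k hk
      omega
    · intro k hk
      have := lt_of_mem k hk
      omega
    · intro k hk
      have := lt_of_mem k hk
      have e : 2 * Real.pi * ((q - k : ℕ) : ℝ) * n / q
          = n * (2 * Real.pi) - 2 * Real.pi * k * n / q := by
        rw [Nat.cast_sub this.le]
        field_simp
      simp only [e, Real.sin_nat_mul_two_pi_sub, neg_neg]
  · refine Finset.sum_eq_zero fun k hk => ?_
    simp only [Finset.mem_filter, Finset.mem_Icc] at hk
    obtain rfl : q = 1 := by omega
    obtain rfl : k = 1 := by omega
    have := Real.sin_nat_mul_pi (2 * n)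
    push_cast at this
    rw [← this]
    congr 1
    push_cast
    ring

theorem ramanujanSum_mul_ramanujanSum (q r n m : ℕ) :
    ramanujanSum q n * ramanujanSum r m =
      ∑ k ∈ (Finset.Icc 1 q).filter (fun k => Nat.gcd k q = 1),
        ∑ l ∈ (Finset.Icc 1 r).filter (fun l => Nat.gcd l r = 1),
          Real.cos (2 * Real.pi * k * n / q - 2 * Real.pi * l * m / r) := by
  simp only [Real.cos_sub, Finset.sum_add_distrib, ← Finset.sum_mul_sum]
  rw [sum_coprime_sin_eq_zero, zero_mul, add_zero]
  rfl

theorem tendsto_mean_cos_sub {q r k l : ℕ} (hk : k ∈ Finset.Icc 1 q) (hl : l ∈ Finset.Icc 1 r)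
    (h : ℕ) :
    Tendsto (fun N : ℕ => (1 / (N : ℝ)) * ∑ n ∈ Finset.Icc 1 N,
        Real.cos (2 * Real.pi * k * n / q - 2 * Real.pi * l * (n + h : ℕ) / r)) atTop
      (nhds (if k * r = l * q then Real.cos (2 * Real.pi * l * h / r) else 0)) := by
  rw [Finset.mem_Icc] at hk hl
  have hq : (0 : ℝ) < q := by exact_mod_cast (by omega : 0 < q)
  have hr : (0 : ℝ) < r := by exact_mod_cast (by omega : 0 < r)
  have arg : ∀ n : ℕ, 2 * Real.pi * k * n / q - 2 * Real.pi * l * (n + h : ℕ) / r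
      = (2 * Real.pi * ((k : ℝ) / q - l / r)) * n + -(2 * Real.pi * l * h / r) := by
    intro n
    push_cast
    ring
  simp only [arg]
  split_ifs with heq
  · have e : (k : ℝ) / q - l / r = 0 := by
      rw [sub_eq_zero, div_eq_div_iff hq.ne' hr.ne']
      exact_mod_cast heq
    simp only [e, mul_zero, zero_mul, zero_add, Real.cos_neg, Finset.sum_const, Nat.card_Icc,
      Nat.add_sub_cancel, nsmul_eq_mul]
    refine tendsto_const_nhds.congr' ?_
    filter_upwards [eventually_gt_atTop 0] with N hN
    have : (N : ℝ) ≠ 0 := by positivity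
    field_simp
  · refine tendsto_mean_cos_zero _ _ ?_
    have hne : (k : ℝ) / q - l / r ≠ 0 := by
      rw [Ne, sub_eq_zero, div_eq_div_iff hq.ne' hr.ne']
      exact_mod_cast heq
    have k0 : (0 : ℝ) < k / q := div_pos (by exact_mod_cast hk.1) hq
    have l0 : (0 : ℝ) < l / r := div_pos (by exact_mod_cast hl.1) hr
    have k1 : (k : ℝ) / q ≤ 1 := (div_le_one hq).mpr (by exact_mod_cast hk.2)
    have l1 : (l : ℝ) / r ≤ 1 := (div_le_one hr).mpr (by exact_mod_cast hl.2)
    have e : 2 * Real.pi * ((k : ℝ) / q - l / r) / 2 = Real.pi * ((k : ℝ) / q - l / r) := by ring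
    rw [e, Ne, Real.sin_eq_zero_iff_of_lt_of_lt (by nlinarith [Real.pi_pos])
      (by nlinarith [Real.pi_pos])]
    exact mul_ne_zero Real.pi_ne_zero hne

/-- Orthogonality of Ramanujan sums: the mean value of `c_q(n) c_r(n + h)` is `c_q(h)` if `q = r`
and `0` otherwise. -/
theorem tendsto_mean_ramanujanSum_mul (q r h : ℕ) :
    Tendsto (fun N : ℕ => (1 / (N : ℝ)) * ∑ n ∈ Finset.Icc 1 N,
        ramanujanSum q n * ramanujanSum r (n + h)) atTop
      (nhds (if q = r then ramanujanSum q h else 0)) := by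
  have key : Tendsto (fun N : ℕ =>
      ∑ k ∈ (Finset.Icc 1 q).filter (fun k => Nat.gcd k q = 1),
        ∑ l ∈ (Finset.Icc 1 r).filter (fun l => Nat.gcd l r = 1),
          (1 / (N : ℝ)) * ∑ n ∈ Finset.Icc 1 N,
            Real.cos (2 * Real.pi * k * n / q - 2 * Real.pi * l * (n + h : ℕ) / r)) atTop
      (nhds (∑ k ∈ (Finset.Icc 1 q).filter (fun k => Nat.gcd k q = 1),
        ∑ l ∈ (Finset.Icc 1 r).filter (fun l => Nat.gcd l r = 1),
          if k * r = l * q then Real.cos (2 * Real.pi * l * h / r) else 0)) :=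
    tendsto_finsetSum _ fun k hk => tendsto_finsetSum _ fun l hl =>
      tendsto_mean_cos_sub (Finset.mem_filter.mp hk).1 (Finset.mem_filter.mp hl).1 h
  convert key using 2
  · simp only [ramanujanSum_mul_ramanujanSum, ← Finset.mul_sum]
    rw [Finset.sum_comm]
    congr 1
    exact Finset.sum_congr rfl fun k _ => Finset.sum_comm
  · split_ifs with hqr
    · subst hqr
      refine Finset.sum_congr rfl fun k hk => ?_
      have hq : 0 < q := by
        simp only [Finset.mem_filter, Finset.mem_Icc] at hk
        omega
      simp only [Nat.mul_left_inj hq.ne', Finset.sum_ite_eq, hk, if_true]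
    · symm
      refine Finset.sum_eq_zero fun k hk => Finset.sum_eq_zero fun l hl => if_neg fun heq => hqr ?_
      have hk' : Nat.Coprime k q := (Finset.mem_filter.mp hk).2
      have hl' : Nat.Coprime l r := (Finset.mem_filter.mp hl).2
      exact Nat.dvd_antisymm
        (hk'.symm.dvd_of_dvd_mul_left (heq ▸ dvd_mul_left q l))
        (hl'.symm.dvd_of_dvd_mul_left (heq ▸ dvd_mul_left r k))

/-- The Wiener–Khintchine formula for arithmetical functions: if
`a(n) = ∑_{q≥1} a_q c_q(n)` converges absolutely and uniformly in `n`
(witnessed by a summable majorant `M` with `|a_q c_q(n)| ≤ M q` for all `n ≥ 1`),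
then `lim_{N→∞} (1/N) ∑_{n≤N} a(n) a(n+h) = ∑_{q=1}^∞ a_q² c_q(h)`. -/
theorem wienerKhintchine_ramanujanFourier (a : ℕ → ℝ) (aq : ℕ → ℝ) (M : ℕ → ℝ)
    (hbound : ∀ q n : ℕ, 1 ≤ q → 1 ≤ n → |aq q * ramanujanSum q n| ≤ M q)
    (hM : Summable M)
    (hconv : ∀ n : ℕ, 1 ≤ n →
      HasSum (fun q : ℕ => aq (q + 1) * ramanujanSum (q + 1) n) (a n)) :
    ∀ h : ℕ, 1 ≤ h →
      Tendsto (fun N : ℕ => (1 / (N : ℝ)) *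
          ∑ n ∈ Finset.Icc 1 N, a n * a (n + h)) atTop
        (nhds (∑' q : ℕ, (aq (q + 1)) ^ 2 * ramanujanSum (q + 1) h)) := by
  intro h _
  set F : ℕ × ℕ → ℕ → ℝ := fun p n =>
    (aq (p.1 + 1) * ramanujanSum (p.1 + 1) n) *
      (aq (p.2 + 1) * ramanujanSum (p.2 + 1) (n + h))
  have hM' : Summable fun q => M (q + 1) := (summable_nat_add_iff 1).mpr hM
  have hM0 : ∀ q, 0 ≤ M (q + 1) := fun q =>
    (abs_nonneg _).trans (hbound (q + 1) 1 (by omega) le_rfl)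
  have hMM : Summable fun p : ℕ × ℕ => M (p.1 + 1) * M (p.2 + 1) :=
    hM'.mul_of_nonneg hM' hM0 hM0
  have hFM : ∀ p n, 1 ≤ n → |F p n| ≤ M (p.1 + 1) * M (p.2 + 1) := by
    intro p n hn
    rw [show F p n = _ from rfl, abs_mul]
    exact mul_le_mul (hbound _ _ (by omega) hn) (hbound _ _ (by omega) (by omega))
      (abs_nonneg _) (hM0 _)
  have hFsum : ∀ n, 1 ≤ n → HasSum (fun p => F p n) (a n * a (n + h)) := by
    intro n hn
    have hs : Summable fun p => F p n := .of_norm_bounded hMM fun p => hFM p n hn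
    have hshift := hconv (n + h) (by omega)
    have hprod := (hconv n hn).mul hshift hs
    exact hprod
  have hmean : ∀ N : ℕ, (1 / (N : ℝ)) * ∑ n ∈ Finset.Icc 1 N, a n * a (n + h)
      = ∑' p, (1 / (N : ℝ)) * ∑ n ∈ Finset.Icc 1 N, F p n := fun N =>
    ((hasSum_sum fun n hn => hFsum n (Finset.mem_Icc.mp hn).1).mul_left _).tsum_eq.symm
  have hdiag : ∑' q : ℕ, (aq (q + 1)) ^ 2 * ramanujanSum (q + 1) h
      = ∑' p : ℕ × ℕ, aq (p.1 + 1) * aq (p.2 + 1) *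
          (if p.1 + 1 = p.2 + 1 then ramanujanSum (p.1 + 1) h else 0) := by
    have inj : Function.Injective fun q : ℕ => (q, q) := fun _ _ e => congrArg Prod.fst e
    rw [← inj.tsum_eq]
    · simp only [if_true, sq]
    · rintro ⟨q, r⟩ hp
      by_cases e : q = r
      · exact ⟨q, by rw [e]⟩
      · simp [e] at hp
  simp only [hmean]
  rw [hdiag]
  refine tendsto_tsum_of_dominated_convergence hMM (fun p => ?_) (.of_forall fun N p => ?_)
  · refine ((tendsto_mean_ramanujanSum_mul (p.1 + 1) (p.2 + 1) h).const_mul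
      (aq (p.1 + 1) * aq (p.2 + 1))).congr fun N => ?_
    simp only [F, Finset.mul_sum]
    exact Finset.sum_congr rfl fun n _ => by ring
  · rcases N.eq_zero_or_pos with rfl | hN
    · simpa using mul_nonneg (hM0 p.1) (hM0 p.2)
    · have hN' : (0 : ℝ) < N := by exact_mod_cast hN
      have hle : |∑ n ∈ Finset.Icc 1 N, F p n| ≤ N * (M (p.1 + 1) * M (p.2 + 1)) := by
        refine (Finset.abs_sum_le_sum_abs _ _).trans ?_
        refine (Finset.sum_le_card_nsmul _ _ _
          fun n hn => hFM p n (Finset.mem_Icc.mp hn).1).trans_eq ?_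
        simp
      rw [Real.norm_eq_abs, abs_mul, abs_of_pos (by positivity), one_div_mul_eq_div,
        div_le_iff₀ hN']
      linarith
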